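/- arXiv:2410.16968 — 2 statements merged into one kernel-verified Lean document; each statement's English description precedes it below -/
import Mathlib

section
/- Let σ ≥ 2 and 1 ≤ w ≤ k. Then DR_σ(k+1,w) = 2/(w+1) + (1/σ)·(DR_σ(k,w) − 2/(w+1)). -/
open Finset

/-- The `i`-th length-`k` substring (`k`-mer) of a word of length `w + k`
over the alphabet `Fin σ`. -/
def kmerAt (σ k w : ℕ) (v : Fin (w + k) → Fin σ) (i : Fin (w + 1)) : Fin k → Fin σ :=
  fun j => v ⟨i.1 + j.1, by have h1 := i.2; have h2 := j.2; omega⟩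

/-- `v` is a gamechanger with respect to the linear order (ranking) `ρ` on `k`-mers:
either its `k`-prefix is a `ρ`-minimal `k`-mer of `v`, or its `k`-suffix is a
`ρ`-minimal `k`-mer of `v` occurring exactly once in `v`. -/
def IsGC (σ k w : ℕ) (ρ : (Fin k → Fin σ) ≃ Fin (σ ^ k)) (v : Fin (w + k) → Fin σ) : Prop :=
  (∀ i : Fin (w + 1), ρ (kmerAt σ k w v 0) ≤ ρ (kmerAt σ k w v i)) ∨
  ((∀ i : Fin (w + 1), ρ (kmerAt σ k w v (Fin.last w)) ≤ ρ (kmerAt σ k w v i)) ∧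
    (∀ i : Fin (w + 1), kmerAt σ k w v i = kmerAt σ k w v (Fin.last w) → i = Fin.last w))

/-- `P_{σ,k}(v)`: the fraction of linear orders `ρ` on `σ`-ary `k`-strings for which
`v` is a gamechanger. -/
noncomputable def Pgc (σ k w : ℕ) (v : Fin (w + k) → Fin σ) : ℝ :=
  (Nat.card {ρ : (Fin k → Fin σ) ≃ Fin (σ ^ k) // IsGC σ k w ρ v} : ℝ) /
    (Nat.card ((Fin k → Fin σ) ≃ Fin (σ ^ k)) : ℝ)

/-- `D_ρ`: the fraction of gamechangers among all `σ`-ary strings of length `w + k`. -/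
noncomputable def Dens (σ k w : ℕ) (ρ : (Fin k → Fin σ) ≃ Fin (σ ^ k)) : ℝ :=
  (Nat.card {v : Fin (w + k) → Fin σ // IsGC σ k w ρ v} : ℝ) / ((σ : ℝ) ^ (w + k))

/-- `DR_σ(k,w)`: the expected density, i.e. the average of `D_ρ` over all orders `ρ`. -/
noncomputable def DR (σ k w : ℕ) : ℝ :=
  (∑ ρ : (Fin k → Fin σ) ≃ Fin (σ ^ k), Dens σ k w ρ) /
    (Nat.card ((Fin k → Fin σ) ≃ Fin (σ ^ k)) : ℝ)

/-- `DFR_σ(k,w) = (w+1) · DR_σ(k,w)`, the expected density factor. -/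
noncomputable def DFR (σ k w : ℕ) : ℝ := ((w : ℝ) + 1) * DR σ k w

/-- The number of distinct `k`-mers of `v`. -/
def numKmers (σ k w : ℕ) (v : Fin (w + k) → Fin σ) : ℕ :=
  (Finset.univ.image (kmerAt σ k w v)).card

/-- `Rep_{σ,k,w}`: the set of `σ`-ary strings of length `w + k` that contain two equal
`k`-substrings at distinct positions. -/
def RepSet (σ k w : ℕ) : Finset (Fin (w + k) → Fin σ) :=
  Finset.univ.filter fun v =>
    ∃ i j : Fin (w + 1), i ≠ j ∧ kmerAt σ k w v i = kmerAt σ k w v j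

/-- `Dev_σ(k,w)`, the deviation of the random order. -/
noncomputable def Dev (σ k w : ℕ) : ℝ :=
  (∑ v ∈ RepSet σ k w, Pgc σ k w v) - (2 / ((w : ℝ) + 1)) * ((RepSet σ k w).card : ℝ)

/-- `p` is a period of the string `s` (of length `n`): `s[i] = s[i+p]` whenever both
positions are inside `s`. -/
def HasPeriod (σ n : ℕ) (s : Fin n → Fin σ) (p : ℕ) : Prop :=
  ∀ (i : ℕ) (h : i + p < n), s ⟨i, by omega⟩ = s ⟨i + p, h⟩

/-- A string is primitive if it is not of the form `u^m` with `m ≥ 2`, equivalently it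
has no period that is a proper divisor of its length. -/
def IsPrimitive (σ n : ℕ) (s : Fin n → Fin σ) : Prop :=
  ¬ ∃ d, d ∣ n ∧ d < n ∧ HasPeriod σ n s d

/-- `Prim_σ(n)`: the number of primitive `σ`-ary strings of length `n`. -/
noncomputable def Prim (σ n : ℕ) : ℕ :=
  Nat.card {s : Fin n → Fin σ // IsPrimitive σ n s}

/-- The substring of `v` of length `ℓ` starting at (0-indexed) position `i`. -/
def subAt (σ n : ℕ) (v : Fin n → Fin σ) (i ℓ : ℕ) (h : i + ℓ ≤ n) : Fin ℓ → Fin σ :=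
  fun j => v ⟨i + j.1, by have := j.2; omega⟩

/-- A string is `p`-periodic if `p` is its minimal period and `p ≤ |s|/2`. -/
def IsPPeriodic (σ n : ℕ) (s : Fin n → Fin σ) (p : ℕ) : Prop :=
  1 ≤ p ∧ 2 * p ≤ n ∧ HasPeriod σ n s p ∧ ∀ q, 1 ≤ q → q < p → ¬ HasPeriod σ n s q

/-- The occurrence `v[i..i+ℓ)` is a run of period `p`: it is `p`-periodic and is not
contained in a longer `p`-periodic substring of `v`. -/
def IsRun (σ n : ℕ) (v : Fin n → Fin σ) (i ℓ p : ℕ) (h : i + ℓ ≤ n) : Prop :=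
  IsPPeriodic σ ℓ (subAt σ n v i ℓ h) p ∧
    ∀ (i' ℓ' : ℕ) (h' : i' + ℓ' ≤ n), i' ≤ i → i + ℓ ≤ i' + ℓ' → ℓ < ℓ' →
      ¬ IsPPeriodic σ ℓ' (subAt σ n v i' ℓ' h') p

/-- A major run: a run `x` of period `p` with `|x| ≥ |v|/2 + p`. -/
def IsMajorRun (σ n : ℕ) (v : Fin n → Fin σ) (i ℓ p : ℕ) (h : i + ℓ ≤ n) : Prop :=
  IsRun σ n v i ℓ p h ∧ n + 2 * p ≤ 2 * ℓ

theorem count_min {α β : Type*} [Fintype α] [DecidableEq α] [Fintype β] [LinearOrder β]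
    (S : Finset α) (x : α) (hx : x ∈ S) :
    Nat.card {ρ : α ≃ β // ∀ y ∈ S, ρ x ≤ ρ y} * S.card = Nat.card (α ≃ β) := by
  classical
  have h1 : ∀ y ∈ S, Nat.card {ρ : α ≃ β // ∀ z ∈ S, ρ y ≤ ρ z}
      = Nat.card {ρ : α ≃ β // ∀ z ∈ S, ρ x ≤ ρ z} := by
    intro y hy
    have key : ∀ a b : α, a ∈ S → b ∈ S → ∀ ρ : α ≃ β, (∀ z ∈ S, ρ a ≤ ρ z) →
        ∀ z ∈ S, ((Equiv.swap a b).trans ρ) b ≤ ((Equiv.swap a b).trans ρ) z := by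
      intro a b ha hb ρ h z hz
      simp only [Equiv.trans_apply, Equiv.swap_apply_right]
      apply h
      rw [Equiv.swap_apply_def]
      split_ifs <;> assumption
    refine Nat.card_congr ⟨fun ρ => ⟨(Equiv.swap y x).trans ρ.1, key y x hy hx ρ.1 ρ.2⟩,
      fun ρ => ⟨(Equiv.swap x y).trans ρ.1, key x y hx hy ρ.1 ρ.2⟩, ?_, ?_⟩
    · rintro ⟨ρ, h⟩
      ext z
      simp [Equiv.swap_comm x y]
    · rintro ⟨ρ, h⟩
      ext z
      simp [Equiv.swap_comm x y]
  have h2 : ∑ y ∈ S, Nat.card {ρ : α ≃ β // ∀ z ∈ S, ρ y ≤ ρ z} = Nat.card (α ≃ β) := by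
    have : ∀ y, Nat.card {ρ : α ≃ β // ∀ z ∈ S, ρ y ≤ ρ z}
        = ((Finset.univ : Finset (α ≃ β)).filter (fun ρ => ∀ z ∈ S, ρ y ≤ ρ z)).card := by
      intro y
      rw [Nat.card_eq_fintype_card, Fintype.card_subtype]
    simp_rw [this]
    rw [← Finset.card_biUnion, Nat.card_eq_fintype_card, ← Finset.card_univ]
    · congr 1
      ext ρ
      simp only [Finset.mem_biUnion, Finset.mem_filter, Finset.mem_univ, true_and, iff_true]
      obtain ⟨y, hy, h⟩ := Finset.exists_min_image S ρ ⟨x, hx⟩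
      exact ⟨y, hy, h⟩
    · intro a ha b hb hab
      rw [Function.onFun, Finset.disjoint_left]
      intro ρ h1 h2
      simp only [Finset.mem_filter, Finset.mem_univ, true_and] at h1 h2
      exact hab (ρ.injective (le_antisymm (h1 b hb) (h2 a ha)))
  rw [Finset.sum_congr rfl h1, Finset.sum_const, smul_eq_mul] at h2
  rw [mul_comm]; exact h2

/-- suffix occurs once -/
def SU (σ k w : ℕ) (v : Fin (w + k) → Fin σ) : Prop :=
  ∀ i : Fin (w + 1), kmerAt σ k w v i = kmerAt σ k w v (Fin.last w) → i = Fin.last w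

open Classical in
theorem pgc_eq (σ k w : ℕ) (hw : 1 ≤ w) (v : Fin (w + k) → Fin σ) :
    Pgc σ k w v = (1 + if SU σ k w v then 1 else 0) / (numKmers σ k w v : ℝ) := by
  have hT : 0 < Nat.card ((Fin k → Fin σ) ≃ Fin (σ ^ k)) := by
    rw [Nat.card_pos_iff]
    refine ⟨⟨Fintype.equivOfCardEq (by simp)⟩, inferInstance⟩
  set S := Finset.univ.image (kmerAt σ k w v) with hS
  have hmem : ∀ i, kmerAt σ k w v i ∈ S := fun i => Finset.mem_image_of_mem _ (Finset.mem_univ i)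
  have hd : 0 < numKmers σ k w v := Finset.card_pos.mpr ⟨_, hmem 0⟩
  have hall : ∀ (ρ : (Fin k → Fin σ) ≃ Fin (σ ^ k)) x, (∀ i, ρ x ≤ ρ (kmerAt σ k w v i)) ↔
      ∀ y ∈ S, ρ x ≤ ρ y := by
    intro ρ x
    simp [hS]
  have hc : ∀ i, Nat.card {ρ : (Fin k → Fin σ) ≃ Fin (σ ^ k) //
      ∀ y ∈ S, ρ (kmerAt σ k w v i) ≤ ρ y} * numKmers σ k w v
      = Nat.card ((Fin k → Fin σ) ≃ Fin (σ ^ k)) := by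
    intro i
    have := count_min (β := Fin (σ ^ k)) S (kmerAt σ k w v i) (hmem i)
    exact this
  have hne : SU σ k w v → kmerAt σ k w v 0 ≠ kmerAt σ k w v (Fin.last w) := by
    intro h h'
    have := congrArg Fin.val (h 0 h')
    simp at this
    omega
  have main : Nat.card {ρ : (Fin k → Fin σ) ≃ Fin (σ ^ k) // IsGC σ k w ρ v} * numKmers σ k w v
      = Nat.card ((Fin k → Fin σ) ≃ Fin (σ ^ k)) * (1 + if SU σ k w v then 1 else 0) := by
    by_cases h : SU σ k w v
    · have e : Nat.card {ρ : (Fin k → Fin σ) ≃ Fin (σ ^ k) // IsGC σ k w ρ v}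
        = Nat.card {ρ : (Fin k → Fin σ) ≃ Fin (σ ^ k) // ∀ y ∈ S, ρ (kmerAt σ k w v 0) ≤ ρ y}
        + Nat.card {ρ : (Fin k → Fin σ) ≃ Fin (σ ^ k) //
            ∀ y ∈ S, ρ (kmerAt σ k w v (Fin.last w)) ≤ ρ y} := by
        simp only [Nat.card_eq_fintype_card]
        rw [← Fintype.card_subtype_or_disjoint]
        · apply Fintype.card_congr
          apply Equiv.subtypeEquivRight
          intro ρ
          rw [← hall, ← hall]
          unfold IsGC
          have : (∀ i : Fin (w + 1), kmerAt σ k w v i = kmerAt σ k w v (Fin.last w) →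
            i = Fin.last w) := h
          tauto
        · rw [Pi.disjoint_iff]
          intro ρ
          rw [Prop.disjoint_iff]
          by_contra hh
          exact hne h (ρ.injective (le_antisymm (hh.1 _ (hmem _)) (hh.2 _ (hmem _))))
      rw [e, add_mul, hc, hc, if_pos h]; ring
    · have e : Nat.card {ρ : (Fin k → Fin σ) ≃ Fin (σ ^ k) // IsGC σ k w ρ v}
        = Nat.card {ρ : (Fin k → Fin σ) ≃ Fin (σ ^ k) // ∀ y ∈ S, ρ (kmerAt σ k w v 0) ≤ ρ y} := by
        apply Nat.card_congr
        apply Equiv.subtypeEquivRight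
        intro ρ
        rw [← hall]
        unfold IsGC
        have : ¬ (∀ i : Fin (w + 1), kmerAt σ k w v i = kmerAt σ k w v (Fin.last w) →
            i = Fin.last w) := h
        tauto
      rw [e, hc, if_neg h]; simp
  unfold Pgc
  rw [div_eq_div_iff (by positivity) (by positivity)]
  have := congrArg (Nat.cast : ℕ → ℝ) main
  push_cast at this
  rw [this]; split_ifs <;> push_cast <;> ring

theorem dr_eq (σ k w : ℕ) :
    DR σ k w = (∑ v, Pgc σ k w v) / (σ : ℝ) ^ (w + k) := by
  classical
  unfold DR Dens Pgc
  rw [← Finset.sum_div, ← Finset.sum_div, div_right_comm]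
  congr 2
  simp only [Nat.card_eq_fintype_card, Fintype.card_subtype, Finset.card_filter]
  push_cast
  exact Finset.sum_comm

/-- period on an interval -/
def Per {A : Type*} (f : ℕ → A) (a b p : ℕ) : Prop :=
  ∀ x, a ≤ x → x + p < b → f x = f (x + p)

theorem Per.mono {A : Type*} {f : ℕ → A} {a b p a' b' : ℕ} (h : Per f a b p) (ha : a ≤ a')
    (hb : b' ≤ b) : Per f a' b' p := fun x h1 h2 => h x (by omega) (by omega)

theorem per_sub {A : Type*} {f : ℕ → A} {a b p q : ℕ} (hp : Per f a b p) (hq : Per f a b q)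
    (h : a + p + q ≤ b) (hqp : q ≤ p) : Per f a b (p - q) := by
  intro x hx hxb
  by_cases h1 : x + p < b
  · rw [hp x hx h1, hq (x + (p - q)) (by omega) (by omega)]
    congr 1; omega
  · have e1 := hq (x - q) (by omega) (by omega)
    have e2 := hp (x - q) (by omega) (by omega)
    rw [show x - q + q = x by omega] at e1
    rw [show x - q + p = x + (p - q) by omega] at e2
    rw [← e1, e2]

theorem per_gcd {A : Type*} {f : ℕ → A} {a b : ℕ} (n : ℕ) : ∀ p q, p + q ≤ n → 1 ≤ p → 1 ≤ q →
    Per f a b p → Per f a b q → a + p + q ≤ b → Per f a b (Nat.gcd p q) := by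
  induction n with
  | zero => intro p q h1 h2; omega
  | succ n ih =>
    intro p q h1 h2 h3 hp hq hb
    rcases lt_trichotomy p q with h | h | h
    · have := ih p (q - p) (by omega) h2 (by omega) hp (per_sub hq hp (by omega) h.le) (by omega)
      rwa [Nat.gcd_sub_self_right h.le] at this
    · subst h; simpa using hp
    · have := ih (p - q) q (by omega) (by omega) h3 (per_sub hp hq (by omega) h.le) hq (by omega)
      rwa [Nat.gcd_sub_self_left h.le] at this

theorem per_ext {A : Type*} {f : ℕ → A} {a b c d q g : ℕ} (hq1 : 1 ≤ q) (hq : Per f a b q)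
    (hg : Per f c d g) (hac : a ≤ c) (hdb : d ≤ b) (h : c + q + g ≤ d) : Per f a b g := by
  have up : ∀ n x, a ≤ x → x + g < d → c - x ≤ n → f x = f (x + g) := by
    intro n
    induction n with
    | zero => intro x hx h1 h2; exact hg x (by omega) h1
    | succ n ih =>
      intro x hx h1 h2
      by_cases hc : c ≤ x
      · exact hg x hc h1
      · have := ih (x + q) (by omega) (by omega) (by omega)
        rw [hq x hx (by omega), hq (x + g) (by omega) (by omega), this]
        congr 1; omega
  intro x
  induction x using Nat.strong_induction_on with
  | _ x ih =>
    intro hx hb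
    by_cases h1 : x + g < d
    · exact up _ x hx h1 le_rfl
    · have e := ih (x - q) (by omega) (by omega) (by omega)
      have e1 := hq (x - q) (by omega) (by omega)
      have e2 := hq (x - q + g) (by omega) (by omega)
      rw [show x - q + q = x by omega] at e1
      rw [show x - q + g + q = x + g by omega] at e2
      rw [← e1, ← e2, e]

/-- equal k-mers at distance p -/
def EE {A : Type*} (w : ℕ) (f : ℕ → A) (k p i : ℕ) : Prop := i + p ≤ w ∧ Per f i (i + p + k) p

def MP {A : Type*} (w : ℕ) (f : ℕ → A) (k p : ℕ) : Prop :=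
  1 ≤ p ∧ (∃ i, EE w f k p i) ∧ ∀ q, 1 ≤ q → q < p → ∀ i, ¬ EE w f k q i

theorem ee_gcd {A : Type*} {w k p q i j : ℕ} {f : ℕ → A} (hwk : w ≤ k) (hp : 1 ≤ p) (hq : 1 ≤ q)
    (hi : EE w f k p i) (hj : EE w f k q j) :
    Per f i (i + p + k) (Nat.gcd p q) ∧ Per f j (j + q + k) (Nat.gcd p q) := by
  obtain ⟨hi1, hi⟩ := hi
  obtain ⟨hj1, hj⟩ := hj
  have g1 : Nat.gcd p q ≤ p := Nat.gcd_le_left _ hp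
  have g2 : Nat.gcd p q ≤ q := Nat.gcd_le_right _ hq
  have key : Per f (max i j) (min (i + p + k) (j + q + k)) (Nat.gcd p q) :=
    per_gcd (p + q) p q le_rfl hp hq (hi.mono (by omega) (by omega)) (hj.mono (by omega) (by omega))
      (by omega)
  exact ⟨per_ext hp hi key (by omega) (by omega) (by omega),
    per_ext hq hj key (by omega) (by omega) (by omega)⟩

theorem mp_unique {A : Type*} {w k p q : ℕ} {f : ℕ → A} (h1 : MP w f k p) (h2 : MP w f k q) :
    p = q := by
  obtain ⟨a1, ⟨i, hi⟩, c1⟩ := h1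
  obtain ⟨a2, ⟨j, hj⟩, c2⟩ := h2
  rcases lt_trichotomy p q with h | h | h
  · exact absurd hi (c2 p a1 h i)
  · exact h
  · exact absurd hj (c1 q a2 h j)

theorem mp_exists {A : Type*} {w k q j : ℕ} {f : ℕ → A} (hq : 1 ≤ q) (h : EE w f k q j) :
    ∃ p, MP w f k p := by
  classical
  have hex : ∃ p, 1 ≤ p ∧ ∃ i, EE w f k p i := ⟨q, hq, j, h⟩
  refine ⟨Nat.find hex, (Nat.find_spec hex).1, (Nat.find_spec hex).2, ?_⟩
  intro r h1 h2 i hi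
  exact Nat.find_min hex h2 ⟨h1, i, hi⟩

theorem mp_back {A : Type*} {w k p q j : ℕ} {f : ℕ → A} (hwk : w ≤ k) (hm : MP w f k p)
    (hq : 1 ≤ q) (hj : EE w f k q j) : p ≤ j + q ∧ EE w f k p (j + q - p) := by
  obtain ⟨hp, ⟨i, hi⟩, hmin⟩ := hm
  obtain ⟨g1, g2⟩ := ee_gcd hwk hp hq hi hj
  have gle : Nat.gcd p q ≤ p := Nat.gcd_le_left _ hp
  have gle2 : Nat.gcd p q ≤ q := Nat.gcd_le_right _ hq
  have gpos : 1 ≤ Nat.gcd p q := Nat.gcd_pos_of_pos_left _ hp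
  have hg : Nat.gcd p q = p := by
    by_contra hne
    refine hmin _ gpos (by omega) i ⟨?_, g1.mono le_rfl (by omega)⟩
    have := hi.1; omega
  rw [hg] at g2 gle2
  have := hj.1
  exact ⟨by omega, by omega, g2.mono (by omega) (by omega)⟩

/-- insertion relation -/
def Rl {A : Type*} [AddCommGroup A] (w k p : ℕ) (f f' : ℕ → A) : Prop :=
  (∀ x, x < k + p → f' x = f x) ∧ f' (k + p) = f' k ∧
  ∀ x, k ≤ x → x + p < w + k → f' (x + 1 + p) - f' (x + 1) = f (x + p) - f x

theorem rl_ee {A : Type*} [AddCommGroup A] {w k p i : ℕ} {f f' : ℕ → A} (hp : 1 ≤ p) (hwk : w ≤ k)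
    (h : Rl w k p f f') : EE w f k p i ↔ EE w f' (k + 1) p i := by
  obtain ⟨h1, h2, h3⟩ := h
  constructor
  · rintro ⟨a, b⟩
    refine ⟨a, ?_⟩
    intro x hx hxb
    rcases lt_trichotomy x k with h | h | h
    · rw [h1 x (by omega), h1 (x + p) (by omega)]
      exact b x hx (by omega)
    · subst h; exact h2.symm
    · have e := h3 (x - 1) (by omega) (by omega)
      rw [← b (x - 1) (by omega) (by omega), sub_self, sub_eq_zero, show x - 1 + 1 = x by omega] at e
      exact e.symm
  · rintro ⟨a, b⟩
    refine ⟨a, ?_⟩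
    intro x hx hxb
    by_cases h : x < k
    · rw [← h1 x (by omega), ← h1 (x + p) (by omega)]
      exact b x hx (by omega)
    · have e := h3 x (by omega) (by omega)
      rw [← b (x + 1) (by omega) (by omega), sub_self] at e
      exact (sub_eq_zero.mp e.symm).symm

theorem rl_mp {A : Type*} [AddCommGroup A] {w k p : ℕ} {f f' : ℕ → A} (hwk : w ≤ k)
    (h : Rl w k p f f') : MP w f k p ↔ MP w f' (k + 1) p := by
  constructor
  · rintro ⟨hp, ⟨i, hi⟩, hmin⟩
    have hi' := (rl_ee hp hwk h).mp hi
    refine ⟨hp, ⟨i, hi'⟩, ?_⟩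
    intro q hq hqp j hj
    obtain ⟨g1, -⟩ := ee_gcd (by omega) hp hq hi' hj
    have gle2 : Nat.gcd p q ≤ q := Nat.gcd_le_right _ hq
    have gpos : 1 ≤ Nat.gcd p q := Nat.gcd_pos_of_pos_left _ hp
    have := hi.1
    have g2 : Per f i (k + p) (Nat.gcd p q) := by
      intro x hx hxb
      rw [← h.1 x (by omega), ← h.1 _ hxb]
      exact g1 x hx (by omega)
    have g3 := per_ext hp hi.2 g2 le_rfl (by omega) (by omega)
    exact hmin _ gpos (by omega) i ⟨by omega, g3.mono le_rfl (by omega)⟩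
  · rintro ⟨hp, ⟨i, hi'⟩, hmin⟩
    have hi := (rl_ee hp hwk h).mpr hi'
    refine ⟨hp, ⟨i, hi⟩, ?_⟩
    intro q hq hqp j hj
    obtain ⟨g1, -⟩ := ee_gcd (by omega) hp hq hi hj
    have gle2 : Nat.gcd p q ≤ q := Nat.gcd_le_right _ hq
    have gpos : 1 ≤ Nat.gcd p q := Nat.gcd_pos_of_pos_left _ hp
    have := hi.1
    have g2 : Per f' i (k + p) (Nat.gcd p q) := by
      intro x hx hxb
      rw [h.1 x (by omega), h.1 _ hxb]
      exact g1 x hx (by omega)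
    have g3 := per_ext hp hi'.2 g2 le_rfl (by omega) (by omega)
    exact hmin _ gpos (by omega) i ⟨by omega, g3.mono le_rfl (by omega)⟩

def recf {A : Type*} [AddCommGroup A] (a b : ℕ → A) (m p x : ℕ) : A :=
  if h : x < m ∨ p = 0 ∨ x = 0 then a x else recf a b m p (x - p) + b x
termination_by x
decreasing_by omega

theorem rec_exists {A : Type*} [AddCommGroup A] (a b : ℕ → A) (m p : ℕ) (hp : 1 ≤ p) (hm : 1 ≤ m) :
    ∃ g : ℕ → A, (∀ x, x < m → g x = a x) ∧ ∀ x, m ≤ x → g x = g (x - p) + b x := by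
  refine ⟨recf a b m p, ?_, ?_⟩
  · intro x hx
    rw [recf, dif_pos (Or.inl hx)]
  · intro x hx
    rw [recf, dif_neg (by omega)]

theorem rl_exists {A : Type*} [AddCommGroup A] (w k p : ℕ) (hp : 1 ≤ p) (f : ℕ → A) :
    ∃ f', Rl w k p f f' := by
  obtain ⟨g, h1, h2⟩ := rec_exists f (fun x => if x = k + p then 0 else f (x - 1) - f (x - 1 - p))
    (k + p) p hp (by omega)
  refine ⟨g, h1, ?_, ?_⟩
  · rw [h2 _ le_rfl]; simp
  · intro x hx _
    rw [h2 (x + 1 + p) (by omega)]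
    simp only [if_neg (show ¬ x + 1 + p = k + p by omega)]
    rw [show x + 1 + p - p = x + 1 by omega, show x + 1 + p - 1 = x + p by omega,
      show x + p - p = x by omega]
    abel

theorem rl_exists' {A : Type*} [AddCommGroup A] (w k p : ℕ) (hp : 1 ≤ p) (f' : ℕ → A)
    (h0 : f' (k + p) = f' k) : ∃ f, Rl w k p f f' := by
  obtain ⟨g, h1, h2⟩ := rec_exists f' (fun x => f' (x + 1) - f' (x + 1 - p))
    (k + p) p hp (by omega)
  refine ⟨g, fun x hx => (h1 x hx).symm, h0, ?_⟩
  · intro x hx _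
    rw [h2 (x + p) (by omega)]
    rw [show x + p - p = x by omega, show x + p + 1 - p = x + 1 by omega,
      show x + p + 1 = x + 1 + p by omega]
    abel

theorem rl_uniq {A : Type*} [AddCommGroup A] {w k p : ℕ} (hp : 1 ≤ p) {f f' g' : ℕ → A}
    (h : Rl w k p f f') (h' : Rl w k p f g') : ∀ x, x < w + k + 1 → f' x = g' x := by
  intro x
  induction x using Nat.strong_induction_on with
  | _ x ih =>
    intro hx
    rcases lt_trichotomy x (k + p) with c | c | c
    · rw [h.1 x c, h'.1 x c]
    · subst c; rw [h.2.1, h'.2.1, ih k (by omega) (by omega)]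
    · have e1 := h.2.2 (x - 1 - p) (by omega) (by omega)
      have e2 := h'.2.2 (x - 1 - p) (by omega) (by omega)
      rw [← e2, ih (x - 1 - p + 1) (by omega) (by omega), sub_left_inj,
        show x - 1 - p + 1 + p = x by omega] at e1
      exact e1

theorem rl_uniq' {A : Type*} [AddCommGroup A] {w k p : ℕ} (hp : 1 ≤ p) {f g f' : ℕ → A}
    (h : Rl w k p f f') (h' : Rl w k p g f') : ∀ x, x < w + k → f x = g x := by
  intro x
  induction x using Nat.strong_induction_on with
  | _ x ih =>
    intro hx
    by_cases c : x < k + p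
    · rw [← h.1 x c, ← h'.1 x c]
    · have e1 := h.2.2 (x - p) (by omega) (by omega)
      have e2 := h'.2.2 (x - p) (by omega) (by omega)
      rw [e2, ih (x - p) (by omega) (by omega), sub_left_inj,
        show x - p + p = x by omega] at e1
      exact e1.symm

theorem rl_congr {A : Type*} [AddCommGroup A] {w k p : ℕ} (hpw : p ≤ w) {f g f' g' : ℕ → A}
    (h : Rl w k p f f') (h1 : ∀ x, x < w + k → f x = g x) (h2 : ∀ x, x < w + k + 1 → f' x = g' x) :
    Rl w k p g g' := by
  obtain ⟨a, b, c⟩ := h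
  refine ⟨fun x hx => ?_, ?_, fun x hx hb => ?_⟩
  · rw [← h1 x (by omega), ← h2 x (by omega), a x hx]
  · rw [← h2 _ (by omega), ← h2 _ (by omega), b]
  · rw [← h2 _ (by omega), ← h2 _ (by omega), ← h1 _ (by omega), ← h1 _ (by omega), c x hx hb]

/-- extension of a word by zeros -/
def xt {σ n : ℕ} [NeZero σ] (v : Fin n → Fin σ) (x : ℕ) : Fin σ :=
  if h : x < n then v ⟨x, h⟩ else 0

theorem kmer_eq {σ k w : ℕ} [NeZero σ] (v : Fin (w + k) → Fin σ) (i j : Fin (w + 1)) :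
    kmerAt σ k w v i = kmerAt σ k w v j ↔ ∀ x, x < k → xt v (i.1 + x) = xt v (j.1 + x) := by
  have hi := i.2
  have hj := j.2
  constructor
  · intro h x hx
    have := congrFun h ⟨x, hx⟩
    unfold xt
    rw [dif_pos (by omega), dif_pos (by omega)]
    exact this
  · intro h
    funext ⟨x, hx⟩
    have := h x hx
    unfold xt at this
    rw [dif_pos (by omega), dif_pos (by omega)] at this
    exact this

theorem kmer_ee {σ k w : ℕ} [NeZero σ] (v : Fin (w + k) → Fin σ) (i j : Fin (w + 1)) (h : i < j) :
    kmerAt σ k w v i = kmerAt σ k w v j ↔ EE w (xt v) k (j.1 - i.1) i.1 := by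
  have hi := i.2
  have hj := j.2
  have hij : i.1 < j.1 := h
  rw [kmer_eq]
  constructor
  · intro H
    refine ⟨by omega, fun x hx hb => ?_⟩
    have := H (x - i.1) (by omega)
    rw [show i.1 + (x - i.1) = x by omega, show j.1 + (x - i.1) = x + (j.1 - i.1) by omega] at this
    exact this
  · rintro ⟨-, H⟩ x hx
    have := H (i.1 + x) (by omega) (by omega)
    rw [show i.1 + x + (j.1 - i.1) = j.1 + x by omega] at this
    exact this

open Classical in
theorem num_eq {σ k w p : ℕ} [NeZero σ] (v : Fin (w + k) → Fin σ) (hwk : w ≤ k)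
    (hm : MP w (xt v) k p) : numKmers σ k w v =
      (Finset.univ.filter fun i : Fin (w + 1) => ¬ (p ≤ i.1 ∧ EE w (xt v) k p (i.1 - p))).card := by
  have hp := hm.1
  have hlt : ∀ i j : Fin (w + 1), i < j → kmerAt σ k w v i = kmerAt σ k w v j →
      p ≤ j.1 ∧ EE w (xt v) k p (j.1 - p) := by
    intro i j hij h
    have hij' : i.1 < j.1 := hij
    rw [kmer_ee v i j hij] at h
    have := mp_back hwk hm (by omega) h
    rwa [show i.1 + (j.1 - i.1) = j.1 by omega] at this
  set S := Finset.univ.filter fun i : Fin (w + 1) => ¬ (p ≤ i.1 ∧ EE w (xt v) k p (i.1 - p)) with hS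
  have himg : Finset.univ.image (kmerAt σ k w v) = S.image (kmerAt σ k w v) := by
    apply Finset.Subset.antisymm
    · intro y hy
      rw [Finset.mem_image] at hy
      obtain ⟨i, -, rfl⟩ := hy
      have : ∀ n (i : Fin (w + 1)), i.1 = n → kmerAt σ k w v i ∈ S.image (kmerAt σ k w v) := by
        intro n
        induction n using Nat.strong_induction_on with
        | _ n ih =>
          intro i hi
          by_cases h : p ≤ i.1 ∧ EE w (xt v) k p (i.1 - p)
          · have h2 := i.2
            have e := (kmer_ee v ⟨i.1 - p, by omega⟩ i (by rw [Fin.lt_def]; simp only; omega)).mpr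
              (by simpa [show i.1 - (i.1 - p) = p by omega] using h.2)
            rw [← e]
            exact ih (i.1 - p) (by omega) _ rfl
          · exact Finset.mem_image_of_mem _ (by rw [hS, Finset.mem_filter]; exact ⟨Finset.mem_univ _, h⟩)
      exact this _ i rfl
    · exact Finset.image_subset_image (Finset.subset_univ _)
  unfold numKmers
  rw [himg, Finset.card_image_of_injOn]
  intro i hi j hj h
  simp only [hS, Finset.coe_filter, Finset.mem_univ, true_and, Set.mem_setOf_eq] at hi hj
  rcases lt_trichotomy i j with c | c | c
  · exact absurd (hlt i j c h) hj
  · exact c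
  · exact absurd (hlt j i c h.symm) hi

theorem su_eq {σ k w p : ℕ} [NeZero σ] (v : Fin (w + k) → Fin σ) (hwk : w ≤ k)
    (hm : MP w (xt v) k p) : SU σ k w v ↔ ¬ EE w (xt v) k p (w - p) := by
  have hp := hm.1
  obtain ⟨i0, hi0⟩ := hm.2.1
  have hpw := hi0.1
  constructor
  · intro h he
    have e := (kmer_ee v ⟨w - p, by omega⟩ (Fin.last w)
      (by rw [Fin.lt_def]; simp only [Fin.val_last]; omega)).mpr
              (by simpa [show w - (w - p) = p by omega] using he)
    have := congrArg Fin.val (h _ e)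
    simp at this
    omega
  · intro h i hi
    by_contra hne
    have hlt : i < Fin.last w := Fin.lt_last_iff_ne_last.mpr hne
    have hlt' : i.1 < w := hlt
    rw [kmer_ee v _ _ hlt] at hi
    simp only [Fin.val_last] at hi
    have := (mp_back hwk hm (by omega) hi).2
    rw [show i.1 + (w - i.1) - p = w - p by omega] at this
    exact h this

open Classical in
noncomputable def FF (σ k w : ℕ) (v : Fin (w + k) → Fin σ) : ℝ :=
  (1 + if SU σ k w v then 1 else 0) / (numKmers σ k w v : ℝ) - 2 / ((w : ℝ) + 1)

theorem ff_zero {σ k w : ℕ} [NeZero σ] (v : Fin (w + k) → Fin σ)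
    (h : ¬ ∃ p, MP w (xt v) k p) : FF σ k w v = 0 := by
  have inj : Function.Injective (kmerAt σ k w v) := by
    intro i j hij
    by_contra hne
    rcases lt_or_gt_of_ne hne with c | c
    · exact h (mp_exists (Nat.sub_pos_of_lt c) ((kmer_ee v i j c).mp hij))
    · exact h (mp_exists (Nat.sub_pos_of_lt c) ((kmer_ee v j i c).mp hij.symm))
  have su : SU σ k w v := fun i hi => inj hi
  unfold FF numKmers
  rw [if_pos su, Finset.card_image_of_injective _ inj]
  simp
  norm_num

theorem ff_eq {σ k w p : ℕ} [NeZero σ] (hwk : w ≤ k) (v : Fin (w + k) → Fin σ)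
    (v' : Fin (w + (k + 1)) → Fin σ)
    (hm : MP w (xt v) k p) (hr : Rl w k p (xt v) (xt v')) :
    FF σ k w v = FF σ (k + 1) w v' := by
  classical
  have hm' := (rl_mp hwk hr).mp hm
  have e : ∀ i, EE w (xt v) k p i ↔ EE w (xt v') (k + 1) p i := fun i => rl_ee hm.1 hwk hr
  have n : numKmers σ k w v = numKmers σ (k + 1) w v' := by
    rw [num_eq v hwk hm, num_eq v' (by omega) hm']
    simp only [e]
  have s : SU σ k w v ↔ SU σ (k + 1) w v' := by
    rw [su_eq v hwk hm, su_eq v' (by omega) hm', e]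
  unfold FF
  rw [n]
  simp only [s]

theorem xt_restrict {σ n : ℕ} [NeZero σ] (f : ℕ → Fin σ) (x : ℕ) (hx : x < n) :
    xt (fun i : Fin n => f i.1) x = f x := by
  unfold xt; rw [dif_pos hx]

theorem xt_inj {σ n : ℕ} [NeZero σ] (v u : Fin n → Fin σ) (h : ∀ x, x < n → xt v x = xt u x) :
    v = u := by
  funext ⟨x, hx⟩
  have := h x hx
  unfold xt at this
  rwa [dif_pos hx, dif_pos hx] at this

theorem sum_ff (σ k w : ℕ) [NeZero σ] (hwk : w ≤ k) :
    ∑ v, FF σ k w v = ∑ v, FF σ (k + 1) w v := by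
  classical
  have hL : ∑ v, FF σ k w v = ∑ v with (∃ p, MP w (xt v) k p), FF σ k w v := by
    rw [Finset.sum_filter_of_ne]
    intro v _ h
    by_contra h'
    exact h (ff_zero v h')
  have hR : ∑ v, FF σ (k + 1) w v
      = ∑ v with (∃ p, MP w (xt v) (k + 1) p), FF σ (k + 1) w v := by
    rw [Finset.sum_filter_of_ne]
    intro v _ h
    by_contra h'
    exact h (ff_zero v h')
  rw [hL, hR]
  have hex : ∀ v : Fin (w + k) → Fin σ, (∃ p, MP w (xt v) k p) →
      ∃ v' : Fin (w + (k + 1)) → Fin σ, ∃ p, MP w (xt v) k p ∧ Rl w k p (xt v) (xt v') := by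
    rintro v ⟨p, hm⟩
    obtain ⟨i0, hi0⟩ := hm.2.1
    have := hi0.1
    obtain ⟨f', hf'⟩ := rl_exists w k p hm.1 (xt v)
    refine ⟨fun i => f' i.1, p, hm, rl_congr (by omega) hf' (fun _ _ => rfl) ?_⟩
    intro x hx
    rw [xt_restrict f' x (by omega)]
  have hex' : ∀ v' : Fin (w + (k + 1)) → Fin σ, (∃ p, MP w (xt v') (k + 1) p) →
      ∃ v : Fin (w + k) → Fin σ, ∃ p, MP w (xt v) k p ∧ Rl w k p (xt v) (xt v') := by
    rintro v' ⟨p, hm⟩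
    obtain ⟨i0, hi0⟩ := hm.2.1
    have := hi0.1
    obtain ⟨f, hf⟩ := rl_exists' w k p hm.1 (xt v') (hi0.2 k (by omega) (by omega)).symm
    have hr : Rl w k p (xt (fun i : Fin (w + k) => f i.1)) (xt v') := by
      refine rl_congr (by omega) hf ?_ (fun _ _ => rfl)
      intro x hx
      rw [xt_restrict f x (by omega)]
    exact ⟨_, p, (rl_mp hwk hr).mpr hm, hr⟩
  have mem : ∀ v : Fin (w + k) → Fin σ, v ∈ Finset.univ.filter (fun v : Fin (w + k) → Fin σ =>
      ∃ p, MP w (xt v) k p) → ∃ p, MP w (xt v) k p := fun v hv => (Finset.mem_filter.mp hv).2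
  refine Finset.sum_bij (fun v hv => Classical.choose (hex v (mem v hv))) ?_ ?_ ?_ ?_
  · intro v hv
    obtain ⟨p, hm, hr⟩ := Classical.choose_spec (hex v (mem v hv))
    rw [Finset.mem_filter]
    exact ⟨Finset.mem_univ _, p, (rl_mp hwk hr).mp hm⟩
  · intro v hv u hu h
    obtain ⟨p, hm, hr⟩ := Classical.choose_spec (hex v (mem v hv))
    obtain ⟨q, hm', hr'⟩ := Classical.choose_spec (hex u (mem u hu))
    rw [← h] at hr'
    have hpq := mp_unique ((rl_mp hwk hr).mp hm) ((rl_mp hwk hr').mp hm')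
    subst hpq
    exact xt_inj _ _ (rl_uniq' hm.1 hr hr')
  · intro v' hv'
    obtain ⟨v, p, hm, hr⟩ := hex' v' (Finset.mem_filter.mp hv').2
    have hv : v ∈ Finset.univ.filter (fun v : Fin (w + k) → Fin σ => ∃ p, MP w (xt v) k p) :=
      Finset.mem_filter.mpr ⟨Finset.mem_univ _, p, hm⟩
    refine ⟨v, hv, ?_⟩
    obtain ⟨q, hm', hr'⟩ := Classical.choose_spec (hex v (mem v hv))
    have hpq := mp_unique hm hm'
    subst hpq
    exact xt_inj _ _ (fun x hx => rl_uniq hm.1 hr' hr x (by omega))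
  · intro v hv
    obtain ⟨p, hm, hr⟩ := Classical.choose_spec (hex v (mem v hv))
    exact ff_eq hwk v _ hm hr

theorem dr_ff (σ k w : ℕ) (hσ : 2 ≤ σ) (hw : 1 ≤ w) :
    DR σ k w = 2 / ((w : ℝ) + 1) + (∑ v, FF σ k w v) / (σ : ℝ) ^ (w + k) := by
  classical
  have hs : (0 : ℝ) < σ := by exact_mod_cast (by omega : 0 < σ)
  have h : ∑ v, FF σ k w v = ∑ v, Pgc σ k w v - (σ : ℝ) ^ (w + k) * (2 / ((w : ℝ) + 1)) := by
    unfold FF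
    rw [Finset.sum_sub_distrib]
    congr 1
    · exact Finset.sum_congr rfl (fun v _ => (pgc_eq σ k w hw v).symm)
    · simp
  rw [h, dr_eq]
  field_simp
  ring

theorem stmt10 (σ k w : ℕ) (hσ : 2 ≤ σ) (hw : 1 ≤ w) (hwk : w ≤ k) :
    DR σ (k + 1) w = 2 / ((w : ℝ) + 1) + (1 / (σ : ℝ)) * (DR σ k w - 2 / ((w : ℝ) + 1)) := by
  haveI : NeZero σ := ⟨by omega⟩
  have hs : (0 : ℝ) < σ := by exact_mod_cast (by omega : 0 < σ)
  rw [dr_ff σ (k + 1) w hσ hw, dr_ff σ k w hσ hw, ← sum_ff σ k w hwk,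
    show w + (k + 1) = (w + k) + 1 by ring, pow_succ]
  field_simp
  ring
end

section
/- Let σ ≥ 2 and w ≥ 1 be fixed. Then there exists a real constant c (depending only on σ and w) such that DR_σ(k,w) = 2/(w+1) + c·σ^{−k} for every k ≥ w. In particular, as k → ∞ the density DR_σ(k,w) approaches 2/(w+1) at exact exponential rate σ. -/
open Finset

/-- `V` has period `g` on the interval `[A,B)`. -/
def PerOn (V : ℕ → ℕ) (A B g : ℕ) : Prop := ∀ t, A ≤ t → t + g < B → V t = V (t + g)

lemma PerOn.fw (V : ℕ → ℕ) (A B : ℕ) : ∀ n p q, p + q ≤ n → 1 ≤ p → 1 ≤ q → A + p + q ≤ B →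
    PerOn V A B p → PerOn V A B q → PerOn V A B (Nat.gcd p q) := by
  intro n
  induction n with
  | zero => intros; omega
  | succ n ih =>
    have key : ∀ p q, p + q ≤ n + 1 → 1 ≤ p → p < q → A + p + q ≤ B →
        PerOn V A B p → PerOn V A B q → PerOn V A B (Nat.gcd p q) := by
      intro p q h1 h2 h3 h4 hp hq
      have : PerOn V A B (q - p) := by
        intro t ht htB
        by_cases hc : t + q < B
        · have e1 := hq t ht hc
          have e2 := hp (t + (q - p)) (by omega) (by omega)
          rw [show t + (q - p) + p = t + q by omega] at e2
          rw [e1, e2]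
        · have e1 := hp (t - p) (by omega) (by omega)
          have e2 := hq (t - p) (by omega) (by omega)
          rw [show t - p + p = t by omega] at e1
          rw [show t - p + q = t + (q - p) by omega] at e2
          rw [← e1, e2]
      have := ih p (q - p) (by omega) h2 (by omega) (by omega) hp this
      rwa [Nat.gcd_sub_self_right h3.le] at this
    intro p q h1 h2 h3 h4 hp hq
    rcases lt_trichotomy p q with h | h | h
    · exact key p q h1 h2 h h4 hp hq
    · subst h; simpa using hp
    · rw [Nat.gcd_comm]; exact key q p (by omega) h3 h (by omega) hq hp

lemma PerOn.extend (V : ℕ → ℕ) (A B C D p d : ℕ) (hp : 1 ≤ p) (hC : A ≤ C) (hD : D ≤ B)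
    (hl : C + p + d ≤ D) (h1 : PerOn V A B p) (h2 : PerOn V C D d) : PerOn V A B d := by
  have : ∀ n t, (C - t) + (t + d + 1 - D) ≤ n → A ≤ t → t + d < B → V t = V (t + d) := by
    intro n
    induction n with
    | zero => intro t hn ht htB; exact h2 t (by omega) (by omega)
    | succ n ih =>
      intro t hn ht htB
      by_cases c1 : t < C
      · have e1 := h1 t ht (by omega)
        have e2 := h1 (t + d) (by omega) (by omega)
        rw [e1, e2, ih (t + p) (by omega) (by omega) (by omega)]
        congr 1; omega
      · by_cases c2 : t + d < D
        · exact h2 t (by omega) c2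
        · have e1 := h1 (t - p) (by omega) (by omega)
          have e2 := h1 (t - p + d) (by omega) (by omega)
          rw [show t - p + p = t by omega] at e1
          rw [show t - p + d + p = t + d by omega] at e2
          rw [← e1, ← e2, ih (t - p) (by omega) (by omega) (by omega)]
  intro t ht htB
  exact this _ t le_rfl ht htB

lemma PerOn.mul (V : ℕ → ℕ) (A B g : ℕ) (h : PerOn V A B g) (m : ℕ) : PerOn V A B (g * m) := by
  induction m with
  | zero => intro t _ _; simp
  | succ m ih =>
    intro t ht htB
    rw [Nat.mul_succ] at htB ⊢
    rw [ih t ht (by omega), h (t + g * m) (by omega) (by omega)]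
    congr 1; omega

lemma PerOn.mono {V : ℕ → ℕ} {A B A' B' g : ℕ} (h : PerOn V A B g) (hA : A ≤ A') (hB : B' ≤ B) :
    PerOn V A' B' g := fun t ht htB => h t (by omega) (by omega)

lemma PerOn.combine (V : ℕ → ℕ) (w k a b g a' b' g' : ℕ) (hk : w ≤ k)
    (hg : 1 ≤ g) (hg' : 1 ≤ g') (h : a + g ≤ b) (h' : a' + g' ≤ b') (hb : b ≤ w) (hb' : b' ≤ w) :
    (PerOn V a (b + k) g ∧ PerOn V a' (b' + k) g') ↔
      PerOn V (min a a') (max b b' + k) (Nat.gcd g g') := by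
  have hd : 1 ≤ Nat.gcd g g' := Nat.gcd_pos_of_pos_left _ hg
  have hd1 : Nat.gcd g g' ≤ g := Nat.gcd_le_left _ hg
  have hd2 : Nat.gcd g g' ≤ g' := Nat.gcd_le_right _ hg'
  constructor
  · rintro ⟨p1, p2⟩
    have hov := PerOn.fw V (max a a') (min b b' + k) (g + g') g g' le_rfl hg hg' (by omega)
      (p1.mono (by omega) (by omega)) (p2.mono (by omega) (by omega))
    have q1 := PerOn.extend V a (b + k) (max a a') (min b b' + k) g _ hg (by omega) (by omega)
      (by omega) p1 hov
    have q2 := PerOn.extend V a' (b' + k) (max a a') (min b b' + k) g' _ hg' (by omega) (by omega)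
      (by omega) p2 hov
    intro t ht htB
    by_cases c1 : a ≤ t ∧ t + Nat.gcd g g' < b + k
    · exact q1 t c1.1 c1.2
    · by_cases c2 : a' ≤ t ∧ t + Nat.gcd g g' < b' + k
      · exact q2 t c2.1 c2.2
      · exact absurd ht (by omega)
  · intro hp
    obtain ⟨m, hm⟩ := Nat.gcd_dvd_left g g'
    obtain ⟨m', hm'⟩ := Nat.gcd_dvd_right g g'
    constructor
    · have := (PerOn.mul V _ _ _ hp m)
      rw [← hm] at this
      exact this.mono (by omega) (by omega)
    · have := (PerOn.mul V _ _ _ hp m')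
      rw [← hm'] at this
      exact this.mono (by omega) (by omega)

lemma PerOn.family (w : ℕ) (S : Finset (Fin (w + 1) × Fin (w + 1))) (hS : S.Nonempty)
    (hlt : ∀ p ∈ S, p.1 < p.2) :
    ∃ a b g, 1 ≤ g ∧ a + g ≤ b ∧ b ≤ w ∧ ∀ k, w ≤ k → ∀ V : ℕ → ℕ,
      (∀ p ∈ S, PerOn V p.1.1 (p.2.1 + k) (p.2.1 - p.1.1)) ↔ PerOn V a (b + k) g := by
  induction hS using Finset.Nonempty.cons_induction with
  | singleton p =>
    have := hlt p (by simp)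
    have h2 := p.2.2
    refine ⟨p.1.1, p.2.1, p.2.1 - p.1.1, ?_, ?_, ?_, ?_⟩ <;> try (simp only [Fin.lt_def] at this; omega)
    intro k _ V
    simp
  | cons p s hp hs ih =>
    obtain ⟨a, b, g, h1, h2, h3, h4⟩ := ih (fun q hq => hlt q (by simp [hq]))
    have h5 := hlt p (by simp)
    have h6 := p.2.2
    rw [Fin.lt_def] at h5
    refine ⟨min p.1.1 a, max p.2.1 b, Nat.gcd (p.2.1 - p.1.1) g, ?_, ?_, ?_, ?_⟩
    · exact Nat.gcd_pos_of_pos_right _ h1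
    · have := Nat.gcd_le_right (n := g) (p.2.1 - p.1.1) h1
      omega
    · omega
    · intro k hk V
      rw [← PerOn.combine V w k _ _ _ _ _ _ hk (by omega) h1 (by omega) h2 (by omega) h3, ← h4 k hk V]
      simp

/-- extension of a finite word by zeros -/
def extW {σ n : ℕ} (v : Fin n → Fin σ) : ℕ → ℕ := fun t => if h : t < n then (v ⟨t, h⟩).1 else 0

lemma extW_lt {σ n : ℕ} (v : Fin n → Fin σ) (t : ℕ) (h : t < n) : extW v t = (v ⟨t, h⟩).1 := by
  simp [extW, h]

lemma kmer_eq_iff (σ k w : ℕ) (v : Fin (w + k) → Fin σ) (i j : Fin (w + 1)) (hij : i < j) :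
    kmerAt σ k w v i = kmerAt σ k w v j ↔ PerOn (extW v) i.1 (j.1 + k) (j.1 - i.1) := by
  rw [Fin.lt_def] at hij
  have hj := j.2
  constructor
  · intro h t ht htB
    have := congrFun h ⟨t - i.1, by omega⟩
    simp only [kmerAt] at this
    rw [extW_lt _ _ (by omega), extW_lt _ _ (by omega)]
    congr 1
    convert this using 3 <;> omega
  · intro h
    funext t
    have ht := t.2
    have := h (i.1 + t.1) (by omega) (by omega)
    rw [extW_lt _ _ (by omega), extW_lt _ _ (by omega)] at this
    have := Fin.ext this
    simp only [kmerAt]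
    convert this using 3
    omega

lemma per_mod (V : ℕ → ℕ) (a B g : ℕ) (hg : 1 ≤ g) (h : PerOn V a B g) (t : ℕ) (ht : a ≤ t)
    (htB : t < B) : V t = V (a + (t - a) % g) := by
  have h1 := PerOn.mul V a B g h ((t - a) / g)
  have h2 := Nat.mod_add_div (t - a) g
  have := h1 (a + (t - a) % g) (by omega) (by omega)
  rw [this]; congr 1; omega

lemma card_per (σ k w a b g : ℕ) (hk : w ≤ k) (hg : 1 ≤ g) (h : a + g ≤ b) (hb : b ≤ w) :
    Nat.card {v : Fin (w + k) → Fin σ // PerOn (extW v) a (b + k) g} = σ ^ (a + g + (w - b)) := by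
  have e : {v : Fin (w + k) → Fin σ // PerOn (extW v) a (b + k) g} ≃
      (Fin (a + g + (w - b)) → Fin σ) :=
    { toFun := fun v s => v.1 ⟨if s.1 < a + g then s.1 else s.1 - (a + g) + (b + k), by
        have := s.2; split_ifs <;> omega⟩
      invFun := fun u => ⟨fun t => u ⟨if t.1 < a then t.1 else if t.1 < b + k then
          a + (t.1 - a) % g else t.1 - (b + k) + (a + g), by
          have := t.2
          have := Nat.mod_lt (t.1 - a) hg
          split_ifs <;> omega⟩, by
        intro t ht htB
        rw [extW_lt _ _ (by omega), extW_lt _ _ (by omega)]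
        congr 2
        apply Fin.ext
        simp only
        rw [if_neg (by omega), if_pos (by omega), if_neg (by omega), if_pos (by omega)]
        rw [show t + g - a = t - a + g by omega, Nat.add_mod_right]⟩
      left_inv := by
        rintro ⟨v, hv⟩
        apply Subtype.ext
        funext t
        have ht := t.2
        have hm := Nat.mod_lt (t.1 - a) hg
        simp only
        by_cases c1 : t.1 < a
        · congr 1
          apply Fin.ext
          simp only [if_pos c1]
          rw [if_pos (by omega)]
        · by_cases c2 : t.1 < b + k
          · have := per_mod _ _ _ _ hg hv t.1 (by omega) c2
            rw [extW_lt _ _ (by omega), extW_lt _ _ (by omega)] at this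
            rw [← Fin.ext_iff] at this
            rw [show t = ⟨t.1, t.2⟩ from rfl, this]
            congr 1
            apply Fin.ext
            simp only [if_neg c1, if_pos c2]
            rw [if_pos (by omega)]
          · congr 1
            apply Fin.ext
            simp only [if_neg c1, if_neg c2]
            rw [if_neg (by omega)]
            omega
      right_inv := by
        intro u
        funext s
        have hs := s.2
        simp only
        congr 1
        apply Fin.ext
        simp only
        by_cases c1 : s.1 < a
        · rw [if_pos (show s.1 < a + g by omega), if_pos c1]
        · by_cases c2 : s.1 < a + g
          · rw [if_pos c2, if_neg c1, if_pos (by omega), Nat.mod_eq_of_lt (by omega)]; omega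
          · rw [if_neg c2, if_neg (by omega), if_neg (by omega)]; omega }
  rw [Nat.card_congr e]
  simp

/-- repetition pattern -/
def pat (σ k w : ℕ) (v : Fin (w + k) → Fin σ) : Finset (Fin (w + 1) × Fin (w + 1)) :=
  univ.filter fun p => p.1 < p.2 ∧ kmerAt σ k w v p.1 = kmerAt σ k w v p.2

lemma cardN (σ w : ℕ) (S : Finset (Fin (w + 1) × Fin (w + 1))) (hS : S.Nonempty) :
    ∃ N : ℕ, ∀ k, w ≤ k → (univ.filter fun v => S ⊆ pat σ k w v).card = N := by
  by_cases hlt : ∀ p ∈ S, p.1 < p.2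
  · obtain ⟨a, b, g, h1, h2, h3, h4⟩ := PerOn.family w S hS hlt
    refine ⟨σ ^ (a + g + (w - b)), fun k hk => ?_⟩
    rw [← card_per σ k w a b g hk h1 h2 h3, ← Fintype.card_subtype, ← Nat.card_eq_fintype_card]
    apply Nat.card_congr
    apply Equiv.subtypeEquivRight
    intro v
    rw [← h4 k hk]
    constructor
    · intro h p hp
      have := h hp
      simp only [pat, mem_filter, mem_univ, true_and] at this
      exact (kmer_eq_iff _ _ _ _ _ _ this.1).1 this.2
    · intro h p hp
      simp only [pat, mem_filter, mem_univ, true_and]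
      exact ⟨hlt p hp, (kmer_eq_iff _ _ _ _ _ _ (hlt p hp)).2 (h p hp)⟩
  · refine ⟨0, fun k _ => ?_⟩
    push Not at hlt
    obtain ⟨p, hp, hp2⟩ := hlt
    rw [Finset.card_eq_zero, Finset.filter_eq_empty_iff]
    intro v _ h
    have := h hp
    simp only [pat, mem_filter, mem_univ, true_and] at this
    exact absurd this.1 (not_lt.2 hp2)

lemma cardM (σ w : ℕ) : ∀ n, ∀ S : Finset (Fin (w + 1) × Fin (w + 1)), S.Nonempty → Sᶜ.card ≤ n →
    ∃ M : ℕ, ∀ k, w ≤ k → (univ.filter fun v => pat σ k w v = S).card = M := by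
  intro n
  induction n using Nat.strong_induction_on with
  | _ n ih =>
    intro S hS hn
    have : ∀ S' : Finset (Fin (w + 1) × Fin (w + 1)), ∃ M : ℕ, S ⊂ S' → ∀ k, w ≤ k →
        (univ.filter fun v => pat σ k w v = S').card = M := by
      intro S'
      by_cases h : S ⊂ S'
      · have hc : S'ᶜ.card < Sᶜ.card := Finset.card_lt_card (by simpa using h)
        obtain ⟨M, hM⟩ := ih S'ᶜ.card (by omega) S' (hS.mono h.subset) le_rfl
        exact ⟨M, fun _ => hM⟩
      · exact ⟨0, fun h' => absurd h' h⟩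
    choose M hM using this
    obtain ⟨N, hN⟩ := cardN σ w S hS
    refine ⟨N - ∑ S' ∈ univ.filter (fun S' => S ⊂ S'), M S', fun k hk => ?_⟩
    rw [← hN k hk]
    have e : (univ.filter fun v => S ⊆ pat σ k w v).card =
        ∑ S' ∈ univ.filter (fun S' => S ⊆ S'), (univ.filter fun v => pat σ k w v = S').card := by
      rw [Finset.card_eq_sum_card_fiberwise (f := pat σ k w) (t := univ.filter (fun S' => S ⊆ S'))]
      · apply Finset.sum_congr rfl
        intro S' hS'
        congr 1
        ext v
        simp only [mem_filter, mem_univ, true_and] at hS' ⊢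
        constructor
        · exact fun h => h.2
        · exact fun h => ⟨h ▸ hS', h⟩
      · intro v hv
        simpa using hv
    have e2 : univ.filter (fun S' => S ⊆ S') = insert S (univ.filter (fun S' => S ⊂ S')) := by
      ext S'
      simp only [mem_filter, mem_univ, true_and, mem_insert]
      rw [subset_iff_ssubset_or_eq]
      tauto
    rw [e, e2, Finset.sum_insert (by simp)]
    rw [Finset.sum_congr rfl (fun S' hS' => hM S' (by simpa using hS') k hk)]
    exact (Nat.add_sub_cancel _ _).symm

lemma card_image_eq {ι α β : Type*} [Fintype ι] [DecidableEq α] [DecidableEq β]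
    (f : ι → α) (g : ι → β) (h : ∀ i j, g i = g j → f i = f j) :
    (univ.image f).card ≤ (univ.image g).card := by
  classical
  rcases isEmpty_or_nonempty ι with he | ⟨⟨i0⟩⟩
  · simp
  have : f = (Function.extend g f (fun _ => f i0)) ∘ g := by
    funext i
    exact (Function.FactorsThrough.extend_apply (fun i j hij => h i j hij) _ i).symm
  rw [this, ← Finset.image_image]
  exact Finset.card_image_le

/-- row of the pattern -/
def rowP (w : ℕ) (T : Finset (Fin (w + 1) × Fin (w + 1))) (i : Fin (w + 1)) : Finset (Fin (w + 1)) :=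
  univ.filter fun j => i = j ∨ (i, j) ∈ T ∨ (j, i) ∈ T

/-- the gamechanger probability in terms of the pattern -/
noncomputable def hP (w : ℕ) (T : Finset (Fin (w + 1) × Fin (w + 1))) : ℝ :=
  (1 + if ∀ i, (i, Fin.last w) ∉ T then 1 else 0) / ((univ.image (rowP w T)).card : ℝ)

lemma mem_rowP (σ k w : ℕ) (v : Fin (w + k) → Fin σ) (i j : Fin (w + 1)) :
    j ∈ rowP w (pat σ k w v) i ↔ kmerAt σ k w v i = kmerAt σ k w v j := by
  simp only [rowP, pat, mem_filter, mem_univ, true_and]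
  rcases lt_trichotomy i j with h | h | h
  · simp [h, h.ne, h.not_gt]
  · simp [h]
  · simp [h, h.ne', h.not_gt, eq_comm]

lemma card_row (σ k w : ℕ) (v : Fin (w + k) → Fin σ) :
    (univ.image (rowP w (pat σ k w v))).card = (univ.image (kmerAt σ k w v)).card := by
  apply le_antisymm
  · apply card_image_eq
    intro i j hij
    ext l
    rw [mem_rowP, mem_rowP, hij]
  · apply card_image_eq
    intro i j hij
    rw [← mem_rowP, hij, mem_rowP]

lemma hP_empty (w : ℕ) : hP w ∅ = 2 / ((w : ℝ) + 1) := by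
  have : (univ.image (rowP w ∅)).card = w + 1 := by
    rw [Finset.card_image_of_injective]
    · simp
    · intro i j hij
      have : j ∈ rowP w ∅ i := by rw [hij]; simp [rowP]
      simpa [rowP] using this
  simp only [hP, this]
  norm_num

lemma min_count {α : Type*} [Fintype α] [DecidableEq α] (n : ℕ) (D : Finset α)
    (x : α) (hx : x ∈ D) :
    (univ.filter fun ρ : α ≃ Fin n => ∀ y ∈ D, ρ x ≤ ρ y).card * D.card = Fintype.card (α ≃ Fin n) := by
  have key : ∀ y ∈ D, (univ.filter fun ρ : α ≃ Fin n => ∀ z ∈ D, ρ y ≤ ρ z).card =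
      (univ.filter fun ρ : α ≃ Fin n => ∀ z ∈ D, ρ x ≤ ρ z).card := by
    have hsw : ∀ y ∈ D, ∀ z ∈ D, Equiv.swap x y z ∈ D := by
      intro y hy z hz
      rw [Equiv.swap_apply_def]; split_ifs <;> assumption
    intro y hy
    refine Finset.card_bij' (fun ρ _ => (Equiv.swap x y).trans ρ) (fun ρ _ => (Equiv.swap x y).trans ρ)
      ?_ ?_ ?_ ?_
    · intro ρ hρ
      simp only [mem_filter, mem_univ, true_and, Equiv.trans_apply, Equiv.swap_apply_left] at hρ ⊢
      exact fun z hz => hρ _ (hsw y hy z hz)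
    · intro ρ hρ
      simp only [mem_filter, mem_univ, true_and, Equiv.trans_apply, Equiv.swap_apply_right] at hρ ⊢
      exact fun z hz => hρ _ (hsw y hy z hz)
    · intro ρ _; ext; simp
    · intro ρ _; ext; simp
  have hu : (univ : Finset (α ≃ Fin n)) =
      D.biUnion (fun y => univ.filter fun ρ : α ≃ Fin n => ∀ z ∈ D, ρ y ≤ ρ z) := by
    ext ρ
    simp only [mem_univ, mem_biUnion, mem_filter, true_and, true_iff]
    exact Finset.exists_min_image D ρ ⟨x, hx⟩
  have hcu := congrArg Finset.card hu
  rw [Finset.card_univ] at hcu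
  rw [hcu, Finset.card_biUnion, Finset.sum_congr rfl key]
  · simp [mul_comm]
  · intro y hy z hz hyz
    change Disjoint _ _
    rw [Finset.disjoint_left]
    intro ρ h1 h2
    simp only [mem_filter, mem_univ, true_and] at h1 h2
    exact hyz (ρ.injective (le_antisymm (h1 z hz) (h2 y hy)))

open Classical in
lemma Pcount (σ k w : ℕ) (hw : 1 ≤ w) (v : Fin (w + k) → Fin σ) :
    ((univ.filter fun ρ => IsGC σ k w ρ v).card : ℝ) =
      hP w (pat σ k w v) * (Fintype.card ((Fin k → Fin σ) ≃ Fin (σ ^ k)) : ℝ) := by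
  set D := univ.image (kmerAt σ k w v) with hD
  have hmem : ∀ i, kmerAt σ k w v i ∈ D := fun i => mem_image_of_mem _ (mem_univ _)
  have hpos : (0 : ℝ) < (D.card : ℝ) := by
    exact_mod_cast Finset.card_pos.2 ⟨_, hmem 0⟩
  have hall : ∀ (ρ : (Fin k → Fin σ) ≃ Fin (σ ^ k)) x,
      (∀ i, ρ x ≤ ρ (kmerAt σ k w v i)) ↔ ∀ y ∈ D, ρ x ≤ ρ y := by
    intro ρ x; simp [hD]
  have c0 := min_count (σ ^ k) D _ (hmem 0)
  have c1 := min_count (σ ^ k) D _ (hmem (Fin.last w))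
  have hu : (∀ i, (i, Fin.last w) ∉ pat σ k w v) ↔
      (∀ i : Fin (w + 1), kmerAt σ k w v i = kmerAt σ k w v (Fin.last w) → i = Fin.last w) := by
    simp only [pat, mem_filter, mem_univ, true_and, not_and]
    constructor
    · intro h i hi
      by_contra hne
      exact h i (Fin.lt_last_iff_ne_last.2 hne) hi
    · intro h i hi e
      exact hi.ne (h i e)
  have hz : (0 : Fin (w + 1)) ≠ Fin.last w := by
    intro h
    have := congrArg Fin.val h
    simp at this
    omega
  unfold hP
  rw [card_row, ← hD, div_mul_eq_mul_div, eq_div_iff hpos.ne', if_congr hu rfl rfl]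
  simp only [IsGC, hall]
  by_cases hc : ∀ i : Fin (w + 1), kmerAt σ k w v i = kmerAt σ k w v (Fin.last w) → i = Fin.last w
  · rw [if_pos hc]
    simp only [and_iff_left hc]
    rw [Finset.filter_or, Finset.card_union_of_disjoint]
    · push_cast
      rw [add_mul]
      have c0' := congrArg (Nat.cast : ℕ → ℝ) c0
      have c1' := congrArg (Nat.cast : ℕ → ℝ) c1
      push_cast at c0' c1'
      convert congrArg₂ (· + ·) c0' c1' using 1
      ring
    · rw [Finset.disjoint_left]
      intro ρ h1 h2
      simp only [mem_filter, mem_univ, true_and] at h1 h2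
      exact hz (hc 0 (ρ.injective (le_antisymm (h1 _ (hmem _)) (h2 _ (hmem _)))))
  · rw [if_neg hc]
    simp only [hc, and_false, or_false]
    have c0' := congrArg (Nat.cast : ℕ → ℝ) c0
    push_cast at c0'
    rw [add_zero, one_mul]
    convert c0' using 1

lemma DR_eq (σ k w : ℕ) (hw : 1 ≤ w) :
    DR σ k w = (∑ v : Fin (w + k) → Fin σ, hP w (pat σ k w v)) / (σ : ℝ) ^ (w + k) := by
  classical
  have hF : (Fintype.card ((Fin k → Fin σ) ≃ Fin (σ ^ k)) : ℝ) ≠ 0 := by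
    have : Nonempty ((Fin k → Fin σ) ≃ Fin (σ ^ k)) := ⟨Fintype.equivFinOfCardEq (by simp)⟩
    exact_mod_cast Fintype.card_ne_zero
  unfold DR Dens
  rw [← Finset.sum_div, Nat.card_eq_fintype_card, div_div, mul_comm, ← div_div]
  congr 1
  rw [div_eq_iff hF, Finset.sum_mul]
  rw [Finset.sum_congr rfl (fun v _ => (Pcount σ k w hw v).symm)]
  have : ∀ ρ : (Fin k → Fin σ) ≃ Fin (σ ^ k), (Nat.card {v : Fin (w + k) → Fin σ // IsGC σ k w ρ v})
      = (univ.filter fun v => IsGC σ k w ρ v).card := by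
    intro ρ
    rw [Nat.card_eq_fintype_card, Fintype.card_subtype]
  simp only [this]
  norm_cast
  exact Finset.sum_card_bipartiteAbove_eq_sum_card_bipartiteBelow (IsGC σ k w)

theorem stmt11 (σ w : ℕ) (hσ : 2 ≤ σ) (hw : 1 ≤ w) :
    ∃ c : ℝ, ∀ k : ℕ, w ≤ k → DR σ k w = 2 / ((w : ℝ) + 1) + c / (σ : ℝ) ^ k := by
  have : ∀ S : Finset (Fin (w + 1) × Fin (w + 1)), ∃ M : ℕ, S.Nonempty → ∀ k, w ≤ k →
      (univ.filter fun v => pat σ k w v = S).card = M := by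
    intro S
    by_cases h : S.Nonempty
    · obtain ⟨M, hM⟩ := cardM σ w _ S h le_rfl
      exact ⟨M, fun _ => hM⟩
    · exact ⟨0, fun h' => absurd h' h⟩
  choose M hM using this
  refine ⟨(∑ S, (M S : ℝ) * (hP w S - hP w ∅)) / (σ : ℝ) ^ w, fun k hk => ?_⟩
  have hσ0 : (σ : ℝ) ≠ 0 := by
    have : σ ≠ 0 := by omega
    exact_mod_cast this
  have e : ∑ v : Fin (w + k) → Fin σ, (hP w (pat σ k w v) - hP w ∅) =
      ∑ S, (M S : ℝ) * (hP w S - hP w ∅) := by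
    rw [← Finset.sum_fiberwise univ (pat σ k w)]
    apply Finset.sum_congr rfl
    intro S _
    rw [Finset.sum_congr rfl (g := fun _ => hP w S - hP w ∅)
      (fun v hv => by rw [(mem_filter.1 hv).2])]
    rw [Finset.sum_const, nsmul_eq_mul]
    rcases S.eq_empty_or_nonempty with h | h
    · subst h; simp
    · rw [hM S h k hk]
  rw [Finset.sum_sub_distrib] at e
  simp only [Finset.sum_const, Finset.card_univ, Fintype.card_fun, Fintype.card_fin, nsmul_eq_mul,
    hP_empty] at e
  push_cast at e
  rw [DR_eq σ k w hw, hP_empty, ← e, pow_add]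
  field_simp
  ring
end
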